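/- arXiv:2206.06181 — 3 statements merged into one kernel-verified Lean document; each statement's English description precedes it below -/
import Mathlib

section
/- Let A = (a_0, …, a_{m−1}) be a base-q sdr with all digits a_i ∈ {0, …, q−1} (and a_i = 0 for i ≥ m). For each i ≥ 0 define e_i ∈ {0,1} by: e_i = 1 if and only if there exists j ∈ {1, …, i} such that a_j = q−1 and a_{j−1} = q−1 and for all k ∈ {j+1, …, i−1} one has (a_k = q−1 or a_{k+1} = q−1) and a_k ≥ q−2. Then the sequence B = (b_0, …, b_m) defined by b_i = a_i − q·e_{i+1} + e_i satisfies: val_q(B) = val_q(A); b_i ∈ {−1, …, q−1} for all i; if b_i = −1 then b_{i+1} = 0; and if b_i = q−1 then b_{i+1} < q−1. -/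
/-- The value `val_q(A) = ∑_{i<m} a_i q^i` of a signed-digit sequence `A` of length `m`. -/
def sdrVal (q : ℤ) (m : ℕ) (A : ℕ → ℤ) : ℤ := ∑ i ∈ Finset.range m, A i * q ^ i

/-- Recursive description of a carry sequence that starts at two consecutive digits `q - 1` and is
propagated by digits that are at least `q - 2`. -/
theorem carry_succ_iff (q : ℤ) (A e : ℕ → ℤ)
    (he : ∀ i, e i = 1 ↔ ∃ j, 1 ≤ j ∧ j ≤ i ∧ A j = q - 1 ∧ A (j - 1) = q - 1 ∧
      ∀ k, j + 1 ≤ k → k + 1 ≤ i → ((A k = q - 1 ∨ A (k + 1) = q - 1) ∧ q - 2 ≤ A k)) (i : ℕ) :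
    e (i + 1) = 1 ↔ (A i = q - 1 ∧ A (i + 1) = q - 1) ∨
      (e i = 1 ∧ (A i = q - 1 ∨ A (i + 1) = q - 1) ∧ q - 2 ≤ A i) := by
  rw [he (i + 1), he i]
  constructor
  · rintro ⟨j, hj1, hji, hAj, hAj', hk⟩
    rcases Nat.lt_or_eq_of_le hji with hlt | rfl
    · refine Or.inr ⟨⟨j, hj1, by omega, hAj, hAj', fun k h1 h2 => hk k h1 (by omega)⟩, ?_⟩
      rcases Nat.lt_or_eq_of_le (Nat.le_of_lt_succ hlt) with h | rfl
      · exact hk i h le_rfl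
      · exact ⟨Or.inl hAj, by omega⟩
    · exact Or.inl ⟨by simpa using hAj', hAj⟩
  · rintro (⟨h1, h2⟩ | ⟨⟨j, hj1, hji, hAj, hAj', hk⟩, h⟩)
    · exact ⟨i + 1, by omega, le_rfl, h2, by simpa using h1, fun k _ _ => by omega⟩
    · refine ⟨j, hj1, by omega, hAj, hAj', fun k h1 h2 => ?_⟩
      rcases Nat.lt_or_eq_of_le (Nat.le_of_succ_le_succ h2) with hlt | rfl
      · exact hk k h1 hlt
      · exact h

/-- Carrying changes the value only by the incoming and the outgoing carry. -/
theorem sdrVal_carry (q : ℤ) (A e B : ℕ → ℤ)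
    (hB : ∀ i, B i = A i - q * e (i + 1) + e i) (n : ℕ) :
    sdrVal q n B = sdrVal q n A + e 0 - e n * q ^ n := by
  induction n with
  | zero => simp [sdrVal]
  | succ n ih =>
    simp only [sdrVal, Finset.sum_range_succ] at ih ⊢
    rw [ih, hB n]
    ring

/-- First step of the compactification: from a base-`q` representation with nonnegative
digits, the carry sequence `e` produces digits in `{-1, …, q-1}` with no `-1` followed by
a nonzero digit and no two consecutive digits of absolute value `q-1`. -/
theorem compact_step_one (q : ℤ) (hq : 2 ≤ q) (m : ℕ) (A : ℕ → ℤ)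
    (hA : ∀ i, 0 ≤ A i ∧ A i ≤ q - 1) (hA0 : ∀ i, m ≤ i → A i = 0)
    (e : ℕ → ℤ)
    (he : ∀ i, (e i = 1 ↔ ∃ j, 1 ≤ j ∧ j ≤ i ∧ A j = q - 1 ∧ A (j - 1) = q - 1 ∧
        ∀ k, j + 1 ≤ k → k + 1 ≤ i → ((A k = q - 1 ∨ A (k + 1) = q - 1) ∧ q - 2 ≤ A k))
      ∧ (e i = 0 ∨ e i = 1))
    (B : ℕ → ℤ) (hB : ∀ i, B i = A i - q * e (i + 1) + e i) :
    sdrVal q (m + 1) B = sdrVal q m A ∧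
    (∀ i, -1 ≤ B i ∧ B i ≤ q - 1) ∧
    (∀ i, B i = -1 → B (i + 1) = 0) ∧
    (∀ i, B i = q - 1 → B (i + 1) < q - 1) := by
  have hrec := carry_succ_iff q A e fun i => (he i).1
  have h01 := fun i => (he i).2
  refine ⟨?_, fun i => ?_, fun i => ?_, fun i => ?_⟩
  · have h0 : e 0 = 0 := by
      refine (h01 0).resolve_right fun h => ?_
      obtain ⟨j, h1, h2, -⟩ := (he 0).1.1 h
      omega
    have hm : e (m + 1) = 0 := by
      refine (h01 (m + 1)).resolve_right fun h => ?_
      have := (hrec m).1 h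
      have := hA0 m le_rfl
      have := hA0 (m + 1) (Nat.le_succ m)
      omega
    rw [sdrVal_carry q A e B hB, h0, hm]
    simp [sdrVal, Finset.sum_range_succ, hA0 m le_rfl]
  · have := hrec i
    have := hA i
    rw [hB i]
    rcases h01 i with h | h <;> rcases h01 (i + 1) with h' | h' <;> rw [h, h'] <;> omega
  · have := hrec i
    have := hrec (i + 1)
    have := hA i
    have := hA (i + 1)
    rw [hB i, hB (i + 1)]
    rcases h01 i with h | h <;> rcases h01 (i + 1) with h' | h' <;>
      rcases h01 (i + 1 + 1) with h'' | h'' <;> rw [h, h', h''] <;> omega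
  · have := hrec i
    have := hrec (i + 1)
    have := hA i
    have := hA (i + 1)
    rw [hB i, hB (i + 1)]
    rcases h01 i with h | h <;> rcases h01 (i + 1) with h' | h' <;>
      rcases h01 (i + 1 + 1) with h'' | h'' <;> rw [h, h', h''] <;> omega
end

section
/- Let B = (b_0, …, b_m) be a base-q sdr with b_i ∈ {−1, …, q−1} for all i (and b_i = 0 for i < 0 or i > m), such that for all i: if b_i = −1 then b_{i+1} = 0, and if b_i = q−1 then b_{i+1} < q−1. For each i ∈ {0, …, m+1} define f_i ∈ {0,1} by: f_i = 1 if and only if there exists j ∈ {i, …, m} such that b_j = −1 and b_ℓ > 0 for all ℓ ∈ {i−1, …, j−1}. Then the sequence C = (c_0, …, c_m) defined by c_i = b_i − q·f_{i+1} + f_i satisfies: val_q(C) = val_q(B); c_i ∈ {−(q−1), …, q−1} for all i; and C is compact. -/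
/-- Second step of the compactification: from a sequence `B` with digits in `{-1, …, q-1}`
(satisfying the output conditions of the first step, with `b_i = 0` outside `{0, …, m}`),
the borrow sequence `f` produces a compact base-`q` signed-digit representation `C` of the
same value. -/
theorem compact_step_two (q : ℤ) (hq : 2 ≤ q) (m : ℕ) (B : ℤ → ℤ)
    (hBrange : ∀ i, -1 ≤ B i ∧ B i ≤ q - 1)
    (hB0 : ∀ i : ℤ, i < 0 ∨ (m : ℤ) < i → B i = 0)
    (hB1 : ∀ i, B i = -1 → B (i + 1) = 0)
    (hB2 : ∀ i, B i = q - 1 → B (i + 1) < q - 1)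
    (f : ℤ → ℤ)
    (hf : ∀ i : ℤ, 0 ≤ i → i ≤ (m : ℤ) + 1 →
      ((f i = 1 ↔ ∃ j : ℤ, i ≤ j ∧ j ≤ (m : ℤ) ∧ B j = -1 ∧
          ∀ l, i - 1 ≤ l → l ≤ j - 1 → 0 < B l)
        ∧ (f i = 0 ∨ f i = 1)))
    (C : ℤ → ℤ)
    (hC : ∀ i : ℤ, C i = if 0 ≤ i ∧ i ≤ (m : ℤ) then B i - q * f (i + 1) + f i else 0) :
    (∑ i ∈ Finset.range (m + 1), C i * q ^ i = ∑ i ∈ Finset.range (m + 1), B i * q ^ i) ∧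
    (∀ i : ℤ, -(q - 1) ≤ C i ∧ C i ≤ q - 1) ∧
    (∀ i : ℤ, 0 ≤ i →
      (|C i| = q - 1 → |C (i + 1)| < q - 1) ∧
      (C i ≠ 0 → C (i + 1) = 0 ∨ Int.sign (C i) = Int.sign (C (i + 1)))) := by
  have pos_of_borrow : ∀ i : ℤ, 0 ≤ i → i ≤ (m : ℤ) + 1 → f i = 1 → 0 < B (i - 1) := by
    intro i h0 h1 h
    obtain ⟨j, hij, -, -, hl⟩ := (hf i h0 h1).1.1 h
    exact hl (i - 1) le_rfl (by omega)
  have borrow_iff : ∀ i : ℤ, 0 ≤ i → i ≤ (m : ℤ) →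
      (f i = 1 ↔ 0 < B (i - 1) ∧ (B i = -1 ∨ f (i + 1) = 1)) := by
    intro i h0 h1
    rw [(hf i h0 (by omega)).1, (hf (i + 1) (by omega) (by omega)).1]
    constructor
    · rintro ⟨j, hij, hjm, hj, hl⟩
      refine ⟨hl (i - 1) le_rfl (by omega), ?_⟩
      rcases eq_or_lt_of_le hij with rfl | hlt
      · exact Or.inl hj
      · exact Or.inr ⟨j, by omega, hjm, hj, fun l h h' => hl l (by omega) h'⟩
    · rintro ⟨hp, hi | ⟨j, hij, hjm, hj, hl⟩⟩
      · refine ⟨i, le_rfl, h1, hi, fun l h h' => ?_⟩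
        obtain rfl : l = i - 1 := by omega
        exact hp
      · refine ⟨j, by omega, hjm, hj, fun l h h' => ?_⟩
        rcases eq_or_lt_of_le h with rfl | hlt
        · exact hp
        · exact hl l (by omega) h'
  have borrow_zero : f 0 = 0 := by
    refine (hf 0 le_rfl (by omega)).2.resolve_right fun h => ?_
    have := pos_of_borrow 0 le_rfl (by omega) h
    have := hB0 (0 - 1) (by omega)
    omega
  have borrow_last : f ((m : ℤ) + 1) = 0 := by
    refine (hf _ (by omega) le_rfl).2.resolve_right fun h => ?_
    obtain ⟨j, hj, hj', -⟩ := (hf _ (by omega) le_rfl).1.1 h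
    omega
  have C_eq : ∀ i : ℤ, 0 ≤ i → i ≤ (m : ℤ) → C i = B i - q * f (i + 1) + f i :=
    fun i h0 h1 => by rw [hC, if_pos ⟨h0, h1⟩]
  have C_zero : ∀ i : ℤ, ¬ (0 ≤ i ∧ i ≤ (m : ℤ)) → C i = 0 :=
    fun i h => by rw [hC, if_neg h]
  have partial_sum : ∀ n : ℕ, n ≤ m + 1 →
      ∑ i ∈ Finset.range n, C i * q ^ i =
        ∑ i ∈ Finset.range n, B i * q ^ i - q ^ n * f n := by
    intro n
    induction n with
    | zero => simp [borrow_zero]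
    | succ k ih =>
      intro hk
      rw [Finset.sum_range_succ, Finset.sum_range_succ, ih (by omega),
        C_eq k (by omega) (by omega)]
      push_cast
      ring
  have C_range : ∀ i : ℤ, -(q - 1) ≤ C i ∧ C i ≤ q - 1 := by
    intro i
    by_cases hi : 0 ≤ i ∧ i ≤ (m : ℤ)
    · have hr := borrow_iff i hi.1 hi.2
      have hp := pos_of_borrow (i + 1) (by omega) (by omega)
      have hb := hBrange i
      rw [add_sub_cancel_right] at hp
      rw [C_eq i hi.1 hi.2]
      rcases (hf i hi.1 (by omega)).2 with h | h <;>
        rcases (hf (i + 1) (by omega) (by omega)).2 with h' | h' <;>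
        simp only [h, h', mul_zero, mul_one] at hr hp ⊢ <;> grind
    · rw [C_zero i hi]
      omega
  refine ⟨?_, C_range, fun i h0 => ?_⟩
  · have := partial_sum (m + 1) le_rfl
    push_cast at this
    rw [this, borrow_last]
    ring
  by_cases him : i + 1 ≤ (m : ℤ)
  · have key : (C i = q - 1 ∨ C i = -(q - 1) → -(q - 1) < C (i + 1) ∧ C (i + 1) < q - 1) ∧
        (C i = 0 ∨ C (i + 1) = 0 ∨ (0 < C i ∧ 0 < C (i + 1)) ∨ (C i < 0 ∧ C (i + 1) < 0)) := by
      have hr := borrow_iff i h0 (by omega)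
      have hr' := borrow_iff (i + 1) (by omega) him
      have hp := pos_of_borrow (i + 1 + 1) (by omega) (by omega)
      have hb := hBrange i
      have hb' := hBrange (i + 1)
      have hB1i := hB1 i
      have hB2i := hB2 i
      rw [add_sub_cancel_right] at hp hr'
      rw [C_eq i h0 (by omega), C_eq (i + 1) (by omega) him]
      rcases (hf i h0 (by omega)).2 with h | h <;>
        rcases (hf (i + 1) (by omega) (by omega)).2 with h' | h' <;>
        rcases (hf (i + 1 + 1) (by omega) (by omega)).2 with h'' | h'' <;>
        simp only [h, h', h'', mul_zero, mul_one] at hr hr' hp ⊢ <;> grind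
    refine ⟨fun h => abs_lt.2 (key.1 ((abs_eq (by omega)).1 h)), fun h => ?_⟩
    rcases key.2 with h1 | h1 | ⟨h1, h2⟩ | ⟨h1, h2⟩
    · exact absurd h1 h
    · exact Or.inl h1
    · exact Or.inr (by rw [Int.sign_eq_one_of_pos h1, Int.sign_eq_one_of_pos h2])
    · exact Or.inr (by rw [Int.sign_eq_neg_one_of_neg h1, Int.sign_eq_neg_one_of_neg h2])
  · have h := C_zero (i + 1) (by omega)
    rw [h, abs_zero]
    exact ⟨fun _ => by omega, fun _ => Or.inl rfl⟩
end

section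
/- For every base-q signed-digit representation A = (a_0, …, a_{m−1}) there exists a compact base-q signed-digit representation B = (b_0, …, b_m) of length m+1 such that val_q(B) = val_q(A). -/
/-- `A` is a base-`q` signed-digit representation of length `m`:
digits lie in `{-(q-1), …, q-1}` and `A i = 0` for `i ≥ m`. -/
def IsSdr (q : ℤ) (m : ℕ) (A : ℕ → ℤ) : Prop :=
  (∀ i, -(q - 1) ≤ A i ∧ A i ≤ q - 1) ∧ (∀ i, m ≤ i → A i = 0)

/-- `A` is compact: if `|a_i| = q-1` then `|a_{i+1}| < q-1`, and if `a_i ≠ 0` then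
`a_{i+1} = 0` or `sgn a_i = sgn a_{i+1}`. -/
def IsCompactSdr (q : ℤ) (A : ℕ → ℤ) : Prop :=
  ∀ i, (|A i| = q - 1 → |A (i + 1)| < q - 1) ∧
    (A i ≠ 0 → A (i + 1) = 0 ∨ Int.sign (A i) = Int.sign (A (i + 1)))

/-- `N` has a compact base-`q` representation of length `m + 1` with lowest digit `d`. -/
def HasCompactSdr (q : ℤ) (m : ℕ) (N d : ℤ) : Prop :=
  ∃ B : ℕ → ℤ, IsSdr q (m + 1) B ∧ IsCompactSdr q B ∧ sdrVal q (m + 1) B = N ∧ B 0 = d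

theorem HasCompactSdr.cons {q : ℤ} {m : ℕ} {N e : ℤ} (h : HasCompactSdr q m N e) (d : ℤ)
    (hl : -(q - 1) ≤ d) (hu : d ≤ q - 1) (hfull : |d| = q - 1 → |e| < q - 1)
    (hsign : d ≠ 0 → e = 0 ∨ Int.sign d = Int.sign e) :
    HasCompactSdr q (m + 1) (q * N + d) d := by
  obtain ⟨B, ⟨hB, hB0⟩, hc, rfl, rfl⟩ := h
  refine ⟨fun i => Nat.casesOn i d B, ⟨?_, ?_⟩, ?_, ?_, rfl⟩
  · rintro (_ | i)
    · exact ⟨hl, hu⟩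
    · exact hB i
  · rintro (_ | i) hi
    · omega
    · exact hB0 i (by omega)
  · rintro (_ | i)
    · exact ⟨hfull, hsign⟩
    · exact hc i
  · unfold sdrVal
    rw [Finset.sum_range_succ' _ (m + 1), Finset.mul_sum]
    simp only [pow_zero, mul_one]
    congr 1
    refine Finset.sum_congr rfl fun i _ => ?_
    ring

theorem HasCompactSdr.cons_zero {q : ℤ} (hq : 2 ≤ q) {m : ℕ} {N e : ℤ}
    (h : HasCompactSdr q m N e) : HasCompactSdr q (m + 1) (q * N) 0 := by
  simpa using h.cons 0 (by omega) (by omega) (fun h => by simp at h; omega) (by simp)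

theorem HasCompactSdr.cons_pos {q : ℤ} {m : ℕ} {N e : ℤ} (h : HasCompactSdr q m N e)
    (he : 0 ≤ e) (heq : e < q - 1) {d : ℤ} (hd : 0 < d) (hdq : d < q) :
    HasCompactSdr q (m + 1) (q * N + d) d := by
  refine h.cons d (by omega) (by omega) (fun _ => by rwa [abs_of_nonneg he]) fun _ => ?_
  rcases he.eq_or_lt with he | he
  · exact Or.inl he.symm
  · exact Or.inr (by rw [Int.sign_eq_one_of_pos hd, Int.sign_eq_one_of_pos he])

theorem HasCompactSdr.cons_neg {q : ℤ} {m : ℕ} {N e : ℤ} (h : HasCompactSdr q m N e)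
    (he : e ≤ 0) (heq : -(q - 1) < e) {d : ℤ} (hd : d < 0) (hdq : -q < d) :
    HasCompactSdr q (m + 1) (q * N + d) d := by
  refine h.cons d (by omega) (by omega) (fun _ => by rw [abs_of_nonpos he]; omega) fun _ => ?_
  rcases he.eq_or_lt with he | he
  · exact Or.inl he
  · exact Or.inr (by rw [Int.sign_eq_neg_one_of_neg hd, Int.sign_eq_neg_one_of_neg he])

theorem hasCompactSdr_zero {q : ℤ} (hq : 2 ≤ q) {N : ℤ} (hl : -1 ≤ N) (hu : N ≤ 1) :
    HasCompactSdr q 0 N N := by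
  refine ⟨fun i => Nat.casesOn i N fun _ => 0, ⟨?_, ?_⟩, ?_, ?_, rfl⟩
  · rintro (_ | i)
    · exact ⟨by simp; omega, by simp; omega⟩
    · exact ⟨by simp; omega, by simp; omega⟩
  · rintro (_ | i) hi
    · omega
    · rfl
  · rintro (_ | i) <;> simp <;> omega
  · simp [sdrVal]

/-- The second conjunct says that of two consecutive integers, either the smaller has a compact
representation which may be preceded by any positive digit, or the larger has one which may be
preceded by any negative digit. -/
theorem exists_hasCompactSdr {q : ℤ} (hq : 2 ≤ q) (m : ℕ) :
    (∀ N, -q ^ m ≤ N → N ≤ q ^ m → ∃ d, HasCompactSdr q m N d) ∧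
    (∀ N, -q ^ m ≤ N → N < q ^ m →
      (∃ d, 0 ≤ d ∧ d < q - 1 ∧ HasCompactSdr q m N d) ∨
      (∃ d, d ≤ 0 ∧ -(q - 1) < d ∧ HasCompactSdr q m (N + 1) d)) := by
  induction m with
  | zero =>
    simp only [pow_zero]
    refine ⟨fun N hl hu => ⟨N, hasCompactSdr_zero hq hl hu⟩, fun N hl hu => ?_⟩
    obtain rfl | rfl : N = 0 ∨ N = -1 := by omega
    · exact Or.inl ⟨0, le_rfl, by omega, hasCompactSdr_zero hq (by omega) (by omega)⟩
    · exact Or.inr ⟨0, le_rfl, by omega, hasCompactSdr_zero hq (by omega) (by omega)⟩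
  | succ m ih =>
    obtain ⟨ih_free, ih_alt⟩ := ih
    have hdiv : ∀ N : ℤ, ∃ M r : ℤ, N = q * M + r ∧ 0 ≤ r ∧ r < q := fun N =>
      ⟨N / q, N % q, (Int.mul_ediv_add_emod N q).symm, Int.emod_nonneg N (by omega),
        Int.emod_lt_of_pos N (by omega)⟩
    have hzero : ∀ M : ℤ, -q ^ (m + 1) ≤ q * M → q * M ≤ q ^ (m + 1) →
        HasCompactSdr q (m + 1) (q * M) 0 := by
      intro M hl hu
      rw [pow_succ] at hl hu
      obtain ⟨e, he⟩ := ih_free M (by nlinarith) (by nlinarith)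
      exact he.cons_zero hq
    have hlow : ∀ M r : ℤ, -q ^ (m + 1) ≤ q * M + r → r < q → -q ^ m ≤ M := by
      intro M r hl hr
      rw [pow_succ] at hl
      by_contra! h
      have : M + 1 ≤ -q ^ m := h
      nlinarith
    have hupp : ∀ M r : ℤ, q * M + r ≤ q ^ (m + 1) → 0 < r → M < q ^ m := by
      intro M r hl hr
      rw [pow_succ] at hl
      by_contra! h
      nlinarith
    refine ⟨fun N hl hu => ?_, fun N hl hu => ?_⟩
    · obtain ⟨M, r, rfl, hr, hrq⟩ := hdiv N
      rcases hr.eq_or_lt with rfl | hr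
      · exact ⟨0, by simpa using hzero M (by simpa using hl) (by simpa using hu)⟩
      rcases ih_alt M (hlow M r hl hrq) (hupp M r hu hr) with ⟨e, he, heq, h⟩ | ⟨e, he, heq, h⟩
      · exact ⟨r, h.cons_pos he heq hr hrq⟩
      · refine ⟨r - q, ?_⟩
        convert h.cons_neg he heq (d := r - q) (by omega) (by omega) using 1
        ring
    · obtain ⟨M, r, rfl, hr, hrq⟩ := hdiv N
      rcases hr.eq_or_lt with rfl | hr
      · refine Or.inl ⟨0, le_rfl, by omega, ?_⟩
        simpa using hzero M (by simpa using hl) (by simpa using hu.le)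
      obtain hrq' | hrq' : r = q - 1 ∨ r < q - 1 := by omega
      · refine Or.inr ⟨0, le_rfl, by omega, ?_⟩
        have hN : q * M + r + 1 = q * (M + 1) := by rw [hrq']; ring
        rw [hN]
        exact hzero (M + 1) (by omega) (by omega)
      rcases ih_alt M (hlow M r hl hrq) (hupp M r hu.le hr) with
        ⟨e, he, heq, h⟩ | ⟨e, he, heq, h⟩
      · exact Or.inl ⟨r, hr.le, hrq', h.cons_pos he heq hr hrq⟩
      · refine Or.inr ⟨r + 1 - q, by omega, by omega, ?_⟩
        convert h.cons_neg he heq (d := r + 1 - q) (by omega) (by omega) using 1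
        ring

theorem abs_sdrVal_lt {q : ℤ} (hq : 2 ≤ q) {A : ℕ → ℤ} (m : ℕ)
    (hA : ∀ i, -(q - 1) ≤ A i ∧ A i ≤ q - 1) : |sdrVal q m A| < q ^ m := by
  induction m with
  | zero => simp [sdrVal]
  | succ m ih =>
    have hval : sdrVal q (m + 1) A = sdrVal q m A + A m * q ^ m := Finset.sum_range_succ _ _
    have hpow : 0 < q ^ m := pow_pos (by omega) m
    rw [abs_lt] at ih ⊢
    rw [hval, pow_succ]
    obtain ⟨hl, hu⟩ := hA m
    constructor <;> nlinarith

/-- For every base-`q` signed-digit representation `A = (a_0, …, a_{m-1})` there exists a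
compact base-`q` signed-digit representation `B = (b_0, …, b_m)` of length `m+1` with the
same value. -/
theorem exists_compact_sdr_of_sdr (q : ℤ) (hq : 2 ≤ q) (m : ℕ) (A : ℕ → ℤ)
    (hA : IsSdr q m A) :
    ∃ B : ℕ → ℤ, IsSdr q (m + 1) B ∧ IsCompactSdr q B ∧
      sdrVal q (m + 1) B = sdrVal q m A := by
  have h := abs_lt.1 (abs_sdrVal_lt hq m hA.1)
  obtain ⟨_, B, hB, hc, hv, _⟩ := (exists_hasCompactSdr hq m).1 _ h.1.le h.2.le
  exact ⟨B, hB, hc, hv⟩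
end
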